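/- Let S ⊆ X be a closed subset with Γ₂ ⊆ S such that the subspace topology of S is Hausdorff. Then Γ₂ is both open and closed in the subspace topology of S. Consequently, if in addition S is connected, then S = Γ₂. -/

import Mathlib

/-- The equivalence relation on `ℝ × ℝ^{2n}` whose quotient is the unitary dual of the
`(2n+1)`-dimensional Heisenberg group: `(λ,v) ∼ (μ,w)` iff `λ = μ` and (`λ ≠ 0` or `v = w`). -/
def heisSetoid (n : ℕ) : Setoid (ℝ × (Fin (2 * n) → ℝ)) where
  r p q := p.1 = q.1 ∧ (p.1 ≠ 0 ∨ p.2 = q.2)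
  iseqv := by
    constructor
    · exact fun p => ⟨rfl, Or.inr rfl⟩
    · rintro p q ⟨h1, h2⟩
      refine ⟨h1.symm, ?_⟩
      rcases h2 with h | h
      · exact Or.inl (by rw [← h1]; exact h)
      · exact Or.inr h.symm
    · rintro p q r ⟨h1, h2⟩ ⟨h1', h2'⟩
      refine ⟨h1.trans h1', ?_⟩
      rcases h2 with h | h
      · exact Or.inl h
      · rcases h2' with h' | h'
        · exact Or.inl (by rw [h1]; exact h')
        · exact Or.inr (h.trans h')

/-- The unitary dual of the `(2n+1)`-dimensional Heisenberg group, realized as a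
quotient topological space. -/
abbrev HeisDual (n : ℕ) : Type := Quotient (heisSetoid n)

/-- The quotient map `q : ℝ × ℝ^{2n} → X`. -/
def heisQ (n : ℕ) : ℝ × (Fin (2 * n) → ℝ) → HeisDual n := Quotient.mk (heisSetoid n)

/-- The central parameter `λ` as a function on the dual. -/
def heisParam (n : ℕ) : HeisDual n → ℝ :=
  Quotient.lift (s := heisSetoid n) Prod.fst fun _ _ h => h.1

lemma continuous_heisQ (n : ℕ) : Continuous (heisQ n) :=
  continuous_quotient_mk'

lemma continuous_heisParam (n : ℕ) : Continuous (heisParam n) :=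
  continuous_fst.quotient_lift _

lemma heisQ_eq_of_ne_zero {n : ℕ} {r : ℝ} (hr : r ≠ 0) (v w : Fin (2 * n) → ℝ) :
    heisQ n (r, v) = heisQ n (r, w) :=
  Quotient.sound (s := heisSetoid n) ⟨rfl, Or.inl hr⟩

lemma exists_heisQ_eq {n : ℕ} (x : HeisDual n) : ∃ v, heisQ n (heisParam n x, v) = x := by
  induction x using Quotient.inductionOn with
  | h p => exact ⟨p.2, rfl⟩

lemma range_heisQ_zero (n : ℕ) :
    Set.range (fun v : Fin (2 * n) → ℝ => heisQ n (0, v)) = heisParam n ⁻¹' {0} := by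
  ext x
  constructor
  · rintro ⟨v, rfl⟩
    rfl
  · intro hx
    obtain ⟨v, hv⟩ := exists_heisQ_eq x
    exact ⟨v, by rwa [show heisParam n x = 0 from hx] at hv⟩

/-- Two distinct characters separated in `S` force the points of `S` outside the characters to
have parameter bounded away from zero. -/
lemma eventually_heisQ_notMem {n : ℕ} {S : Set (HeisDual n)} [T2Space S]
    {v w : Fin (2 * n) → ℝ} (hv : heisQ n (0, v) ∈ S) (hw : heisQ n (0, w) ∈ S) (hvw : v ≠ w) :
    ∀ᶠ r in nhds (0 : ℝ), r ≠ 0 → ∀ u, heisQ n (r, u) ∉ S := by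
  have hne : (⟨_, hv⟩ : S) ≠ ⟨_, hw⟩ := fun h =>
    hvw <| (Quotient.exact (s := heisSetoid n) (congrArg Subtype.val h)).2.resolve_left
      fun h0 => h0 rfl
  obtain ⟨U', V', hU', hV', hvU, hwV, hdisj⟩ := t2_separation hne
  obtain ⟨U, hU, rfl⟩ := isOpen_induced_iff.1 hU'
  obtain ⟨V, hV, rfl⟩ := isOpen_induced_iff.1 hV'
  have hc (u : Fin (2 * n) → ℝ) : Continuous fun r : ℝ => heisQ n (r, u) :=
    (continuous_heisQ n).comp (by fun_prop)
  filter_upwards [(hU.preimage (hc v)).mem_nhds hvU, (hV.preimage (hc w)).mem_nhds hwV]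
    with r hrU hrV hr u hu
  have huU : (⟨_, hu⟩ : S) ∈ Subtype.val ⁻¹' U := by
    change heisQ n (r, u) ∈ U
    rwa [heisQ_eq_of_ne_zero hr u v]
  have huV : (⟨_, hu⟩ : S) ∈ Subtype.val ⁻¹' V := by
    change heisQ n (r, u) ∈ V
    rwa [heisQ_eq_of_ne_zero hr u w]
  exact Set.disjoint_left.1 hdisj huU huV

/-- If  is a closed subset of the unitary dual of the Heisenberg group containing the set
of characters Γ₂ = q({0} × ℝ^{2n}) and the relative topology of  is Hausdorff, then
 is closed-open in ; in particular if  is moreover connected then . -/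
theorem stmt5 (n : ℕ) (hn : 1 ≤ n) (S : Set (HeisDual n)) (hScl : IsClosed S)
    (hsub : Set.range (fun v : Fin (2 * n) → ℝ => heisQ n (0, v)) ⊆ S)
    (hT2 : T2Space S) :
    IsOpen {x : S | (x : HeisDual n) ∈ Set.range (fun v : Fin (2 * n) → ℝ => heisQ n (0, v))} ∧
    IsClosed {x : S | (x : HeisDual n) ∈ Set.range (fun v : Fin (2 * n) → ℝ => heisQ n (0, v))} ∧
    (IsConnected S → S = Set.range (fun v : Fin (2 * n) → ℝ => heisQ n (0, v))) := by
  have hc : Continuous fun x : S => heisParam n x :=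
    (continuous_heisParam n).comp continuous_subtype_val
  have : Nonempty (Fin (2 * n)) := ⟨⟨0, by omega⟩⟩
  obtain ⟨v, w, hvw⟩ := exists_pair_ne (Fin (2 * n) → ℝ)
  have hev := eventually_heisQ_notMem (hsub ⟨v, rfl⟩) (hsub ⟨w, rfl⟩) hvw
  rw [range_heisQ_zero] at hsub ⊢
  have hopen : IsOpen {x : S | (x : HeisDual n) ∈ heisParam n ⁻¹' {0}} := by
    rw [isOpen_iff_eventually]
    intro x hx
    have hx0 : heisParam n x = 0 := hx
    rw [← hx0] at hev
    filter_upwards [hc.continuousAt.eventually hev] with y hy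
    by_contra hy0
    obtain ⟨u, hu⟩ := exists_heisQ_eq (y : HeisDual n)
    exact hy (fun h => hy0 (h.trans hx0)) u (hu ▸ y.2)
  have hclosed : IsClosed {x : S | (x : HeisDual n) ∈ heisParam n ⁻¹' {0}} :=
    isClosed_singleton.preimage hc
  refine ⟨hopen, hclosed, fun hS => Set.Subset.antisymm (fun x hx => ?_) hsub⟩
  have : PreconnectedSpace S := isPreconnected_iff_preconnectedSpace.1 hS.isPreconnected
  have hmem : heisQ n (0, v) ∈ heisParam n ⁻¹' {0} := rfl
  have huniv := IsClopen.eq_univ ⟨hclosed, hopen⟩ ⟨⟨_, hsub hmem⟩, hmem⟩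
  exact Set.eq_univ_iff_forall.1 huniv ⟨x, hx⟩
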